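/- arXiv:2108.09787 — 3 statements merged into one kernel-verified Lean document; each statement's English description precedes it below -/
import Mathlib

section
/- Let M be a Malcev algebra over k, V a k-vector space, and let an extending datum (⊲,▷,ω,{·,·}) be given such that the unified product bracket on M⊕V is a Malcev algebra bracket. Then ▷ satisfies the left-module condition: [x,z]▷(y▷q) = [[x,y],z]▷q − x▷([y,z]▷q) + y▷(x▷(z▷q)) − z▷(y▷(x▷q)) for all x,y,z ∈ M and q ∈ V. -/
def IsBilin (k : Type*) [Field k] {A B C : Type*}
    [AddCommGroup A] [Module k A] [AddCommGroup B] [Module k B]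
    [AddCommGroup C] [Module k C] (f : A → B → C) : Prop :=
  (∀ (x y : A) (z : B), f (x + y) z = f x z + f y z) ∧
  (∀ (c : k) (x : A) (z : B), f (c • x) z = c • f x z) ∧
  (∀ (x : A) (y z : B), f x (y + z) = f x y + f x z) ∧
  (∀ (c : k) (x : A) (z : B), f x (c • z) = c • f x z)

def jacF {A : Type*} [AddCommGroup A] (br : A → A → A) (x y z : A) : A :=
  br (br x y) z + br (br y z) x + br (br z x) y

def IsMalcevBracket (k : Type*) [Field k] {A : Type*} [AddCommGroup A] [Module k A]
    (br : A → A → A) : Prop :=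
  IsBilin k br ∧ (∀ x y : A, br x y = - br y x) ∧
  (∀ x y z : A, jacF br x y (br x z) = br (jacF br x y z) x)

def ubr {M V : Type*} [AddCommGroup M] [AddCommGroup V]
    (bm : M → M → M) (tl : M → V → M) (tr : M → V → V)
    (om : V → V → M) (bv : V → V → V) :
    M × V → M × V → M × V :=
  fun p q =>
    (bm p.1 q.1 + tl p.1 q.2 - tl q.1 p.2 + om p.2 q.2,
     tr p.1 q.2 - tr q.1 p.2 + bv p.2 q.2)

/-- The difference of the two sides of the Sagle identity. -/
def sagleDefect {A : Type*} [AddCommGroup A] (br : A → A → A) (x y z t : A) : A :=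
  br (br (br x y) z) t + br (br (br y z) t) x + br (br (br z t) x) y + br (br (br t x) y) z
    - br (br x z) (br y t)

section Sagle

variable {k : Type*} [Field k] {A : Type*} [AddCommGroup A] [Module k A] {br : A → A → A}

theorem sagleDefect_rotate (h : IsMalcevBracket k br) (x y z t : A) :
    sagleDefect br y z t x = sagleDefect br x y z t := by
  obtain ⟨⟨-, -, -, smul_right⟩, anti, -⟩ := h
  have neg_right (a b : A) : br a (-b) = -br a b := by simpa using smul_right (-1) a b
  have e : br (br y t) (br z x) = br (br x z) (br y t) := by
    rw [anti z x, neg_right, anti (br y t), neg_neg]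
  simp only [sagleDefect, e]
  abel

/-- Linearization of the Malcev identity in its repeated variable. -/
theorem sagleDefect_swap (h : IsMalcevBracket k br) (x y z w : A) :
    sagleDefect br w y z x = -sagleDefect br x y z w := by
  obtain ⟨⟨add_left, smul_left, add_right, smul_right⟩, anti, mal⟩ := h
  have neg_left (a b : A) : br (-a) b = -br a b := by simpa using smul_left (-1) a b
  have neg_right (a b : A) : br a (-b) = -br a b := by simpa using smul_right (-1) a b
  have hs := mal (x + w) y z
  have hx := mal x y z
  have hw := mal w y z
  simp only [jacF, add_left, add_right] at hs hx hw
  have quart (a b c d : A) : br (br (br b a) c) d = -br (br (br a b) c) d := by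
    rw [anti b a, neg_left, neg_left]
  have nested (a b c d : A) : br (br a (br b c)) d = -br (br (br b c) a) d := by
    rw [anti a, neg_left]
  have e₁ : br (br w z) (br y x) = br (br x y) (br w z) := by
    rw [anti y x, neg_right, anti (br w z), neg_neg]
  have e₂ : br (br w y) (br x z) = br (br x z) (br y w) := by
    rw [anti w y, neg_left, anti (br y w), neg_neg]
  simp only [sagleDefect, e₁]
  rw [e₂, nested y w z x, nested y x z w, nested y x z x, nested y w z w] at hs
  rw [nested y x z x] at hx
  rw [nested y w z w] at hw
  linear_combination (norm := module) hx + hw - hs + quart x w y z - quart x z y w - quart w z y x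
    + quart x z w y + quart w z x y

/-- The Sagle identity: a Malcev bracket in characteristic not two has zero Sagle defect. -/
theorem sagleDefect_eq_zero (h2 : (2 : k) ≠ 0) (h : IsMalcevBracket k br) (x y z t : A) :
    sagleDefect br x y z t = 0 := by
  have cycle (a b c d : A) : sagleDefect br b c a d = -sagleDefect br a b c d := by
    rw [← sagleDefect_swap h, sagleDefect_rotate h]
  have e : sagleDefect br x y z t = -sagleDefect br x y z t := by
    conv_lhs => rw [cycle z x y t, cycle y z x t, cycle x y z t]
    simp
  have double : (2 : k) • sagleDefect br x y z t = 0 := by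
    rw [two_smul]
    exact add_eq_zero_iff_eq_neg.mpr e
  exact (smul_eq_zero.mp double).resolve_left h2

end Sagle

theorem stmt4 {k : Type*} [Field k] (h2 : (2 : k) ≠ 0) (h3 : (3 : k) ≠ 0) {M V : Type*} [AddCommGroup M] [Module k M] [AddCommGroup V] [Module k V]
    (bm : M → M → M) (hbm : IsMalcevBracket k bm)
    (tl : M → V → M) (htl : IsBilin k tl)
    (tr : M → V → V) (htr : IsBilin k tr)
    (om : V → V → M) (hom : IsBilin k om) (homa : ∀ u v : V, om u v = - om v u)
    (bv : V → V → V) (hbv : IsBilin k bv) (hbva : ∀ u v : V, bv u v = - bv v u)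
    (huni : IsMalcevBracket k (ubr bm tl tr om bv)) :
    ∀ (x y z : M) (q : V),
      tr (bm x z) (tr y q) =
      tr (bm (bm x y) z) q - tr x (tr (bm y z) q)
      + tr y (tr x (tr z q)) - tr z (tr y (tr x q)) := by
  intro x y z q
  have key := congrArg Prod.snd
    (sagleDefect_eq_zero h2 huni (x, (0 : V)) (y, 0) (z, 0) ((0 : M), q))
  have tr_zero (a : M) : tr a 0 = 0 := by simpa using htr.2.2.2 0 a 0
  have tr_neg (a : M) (v : V) : tr a (-v) = -tr a v := by simpa using htr.2.2.2 (-1) a v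
  have tl_zero (a : M) : tl a 0 = 0 := by simpa using htl.2.2.2 0 a 0
  have bv_zero (v : V) : bv v 0 = 0 := by simpa using hbv.2.2.2 0 v 0
  have zero_bv (v : V) : bv 0 v = 0 := by simpa using hbv.2.1 0 0 v
  have om_zero (v : V) : om v 0 = 0 := by simpa using hom.2.2.2 0 v 0
  have zero_om (v : V) : om 0 v = 0 := by simpa using hom.2.1 0 0 v
  simp only [sagleDefect, ubr, Prod.snd_add, Prod.snd_sub, Prod.snd_zero, tr_zero,
    tr_neg, tl_zero, bv_zero, zero_bv, om_zero, zero_om, add_zero, sub_zero,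
    zero_sub, neg_neg] at key
  linear_combination (norm := module) -key
end

section
/- Let M be a Malcev algebra over k, V a k-vector space, and let an extending datum (⊲,▷,ω,{·,·}) be given such that the unified product bracket on M⊕V is a Malcev algebra bracket. Then for all x,y ∈ M and p,q ∈ V: {x▷p, y▷q} + (x⊲p)▷(y▷q) − (y⊲q)▷(x▷p) = {[x,y]▷p, q} + ([x,y]⊲p)▷q − x▷{y▷p, q} − x▷((y⊲p)▷q) + y▷(x▷{p,q}) + {y▷(x▷q), p} − [x⊲q,y]▷p + (y⊲(x▷q))▷p. -/
namespace IsBilin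

variable {k A B C : Type*} [Field k] [AddCommGroup A] [Module k A] [AddCommGroup B] [Module k B]
  [AddCommGroup C] [Module k C] {f : A → B → C}

theorem zero_left (hf : IsBilin k f) (b : B) : f 0 b = 0 := by
  simpa using hf.2.1 0 0 b

theorem zero_right (hf : IsBilin k f) (a : A) : f a 0 = 0 := by
  simpa using hf.2.2.2 0 a 0

theorem neg_left (hf : IsBilin k f) (a : A) (b : B) : f (-a) b = -f a b := by
  simpa using hf.2.1 (-1) a b

theorem neg_right (hf : IsBilin k f) (a : A) (b : B) : f a (-b) = -f a b := by
  simpa using hf.2.2.2 (-1) a b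

end IsBilin

/-- The linearization of the Malcev identity in its repeated variable. -/
theorem IsMalcevBracket.jacF_linearized {k A : Type*} [Field k] [AddCommGroup A] [Module k A]
    {br : A → A → A} (h : IsMalcevBracket k br) (x y z w : A) :
    jacF br x y (br w z) + jacF br w y (br x z) = br (jacF br x y z) w + br (jacF br w y z) x := by
  obtain ⟨⟨addl, -, addr, -⟩, -, malcev⟩ := h
  have hx := malcev x y z
  have hw := malcev w y z
  have hxw := malcev (x + w) y z
  simp only [jacF, addl, addr] at hx hw hxw ⊢
  linear_combination (norm := module) hxw - hx - hw

/-- Sagle's identity: the multilinear form of the Malcev identity in characteristic not two. -/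
theorem IsMalcevBracket.sagle {k A : Type*} [Field k] (h2 : (2 : k) ≠ 0)
    [AddCommGroup A] [Module k A] {br : A → A → A} (h : IsMalcevBracket k br) (x y z t : A) :
    br (br x z) (br y t) = br (br (br x y) z) t + br (br (br y z) t) x
      + br (br (br z t) x) y + br (br (br t x) y) z := by
  have e₁ := h.jacF_linearized x y t z
  have e₂ := h.jacF_linearized y t x z
  have e₃ := h.jacF_linearized t x y z
  obtain ⟨bilin, anti, -⟩ := h
  apply smul_right_injective A h2
  simp only [jacF, bilin.1, bilin.neg_left, bilin.neg_right, neg_neg, anti y x, anti z x, anti t x, anti z y,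
    anti t y, anti t z, fun a b => anti x (br a b), fun a b => anti y (br a b),
    fun a b => anti t (br a b), anti (br y t) (br x z),
    anti (br z t) (br x y), anti (br y z) (br x t)] at e₁ e₂ e₃ ⊢
  linear_combination (norm := module) e₂ + e₃ - e₁

theorem stmt6 {k : Type*} [Field k] (h2 : (2 : k) ≠ 0) (h3 : (3 : k) ≠ 0) {M V : Type*} [AddCommGroup M] [Module k M] [AddCommGroup V] [Module k V]
    (bm : M → M → M) (hbm : IsMalcevBracket k bm)
    (tl : M → V → M) (htl : IsBilin k tl)
    (tr : M → V → V) (htr : IsBilin k tr)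
    (om : V → V → M) (hom : IsBilin k om) (homa : ∀ u v : V, om u v = - om v u)
    (bv : V → V → V) (hbv : IsBilin k bv) (hbva : ∀ u v : V, bv u v = - bv v u)
    (huni : IsMalcevBracket k (ubr bm tl tr om bv)) :
    ∀ (x y : M) (p q : V),
      bv (tr x p) (tr y q) + tr (tl x p) (tr y q) - tr (tl y q) (tr x p) =
      bv (tr (bm x y) p) q + tr (tl (bm x y) p) q - tr x (bv (tr y p) q) - tr x (tr (tl y p) q)
      + tr y (tr x (bv p q)) + bv (tr y (tr x q)) p - tr (bm (tl x q) y) p + tr (tl y (tr x q)) p := by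
  intro x y p q
  have sagle := congrArg Prod.snd (huni.sagle h2 (x, 0) (y, 0) (0, p) (0, q))
  have hbm := hbm.1
  simp only [ubr, Prod.snd_add, hbm.zero_left, hbm.zero_right, htl.zero_left, htl.zero_right,
    htr.zero_left, htr.zero_right, hom.zero_left, hom.zero_right, hbv.zero_left, hbv.zero_right,
    add_zero, zero_add, neg_zero, hbm.neg_left, htl.neg_right, htr.neg_left,
    htr.neg_right, htr.1, htr.2.2.1, sub_eq_add_neg, neg_neg] at sagle ⊢
  linear_combination (norm := module) sagle
end

section
/- Let M be a Malcev algebra over k, V a k-vector space, and let (⊲,▷,ω,{·,·}) and (⊲',▷',ω',{·,·}') be two extending data both of whose unified product brackets make M⊕V a Malcev algebra (denoted M♮V and M♮'V). For linear maps r : V→M and s : V→V define ψ_{(r,s)} : M⊕V → M⊕V by ψ_{(r,s)}(x,u) = (x + r(u), s(u)). Then: (1) ψ_{(r,s)} is a morphism of Malcev algebras from M♮V to M♮'V if and only if for all x ∈ M and u,v ∈ V: (i) s(x▷v) = x▷'s(v); (ii) x⊲v + r(x▷v) = [x, r(v)] + x⊲'s(v); (iii) s({u,v}) = {s(u),s(v)}'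 + r(u)▷'s(v) − r(v)▷'s(u); (iv) ω(u,v) + r({u,v}) = [r(u), r(v)] + r(u)⊲'s(v) − r(v)⊲'s(u) + ω'(s(u),s(v)). (2) Every morphism of Malcev algebras ψ : M♮V → M♮'V satisfying ψ(x,0) = (x,0) for all x ∈ M equals ψ_{(r,s)} for a unique such pair (r,s). (3) ψ_{(r,s)} is an isomorphism if and only if s is bijective, and ψ_{(r,s)} co-stabilizes V (i.e., its V-component of ψ(x,u) equals u for all x,u) if and only if s = id_V. -/
section

variable {k : Type*} [Field k]

namespace IsBilin

variable {A B C : Type*} [AddCommGroup A] [Module k A] [AddCommGroup B] [Module k B]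
  [AddCommGroup C] [Module k C] {f : A → B → C}

theorem map_add_left (hf : IsBilin k f) (x y : A) (z : B) : f (x + y) z = f x z + f y z :=
  hf.1 x y z

theorem map_add_right (hf : IsBilin k f) (x : A) (y z : B) : f x (y + z) = f x y + f x z :=
  hf.2.2.1 x y z

theorem map_zero_left (hf : IsBilin k f) (z : B) : f 0 z = 0 := by
  simpa using hf.2.1 0 0 z

theorem map_zero_right (hf : IsBilin k f) (x : A) : f x 0 = 0 := by
  simpa using hf.2.2.2 0 x 0

end IsBilin

variable {M V : Type*} [AddCommGroup M] [Module k M] [AddCommGroup V] [Module k V]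

theorem ubr_shear_iff {bm : M → M → M} (hbm : IsBilin k bm) (hbma : ∀ x y, bm x y = - bm y x)
    {tl : M → V → M} (htl : IsBilin k tl) {tr : M → V → V} (htr : IsBilin k tr)
    {om : V → V → M} (hom : IsBilin k om) {bv : V → V → V} (hbv : IsBilin k bv)
    {tl' : M → V → M} (htl' : IsBilin k tl') {tr' : M → V → V} (htr' : IsBilin k tr')
    {om' : V → V → M} (hom' : IsBilin k om') {bv' : V → V → V} (hbv' : IsBilin k bv')
    (r : V →ₗ[k] M) (s : V →ₗ[k] V) :
    (∀ p q : M × V,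
      (fun z : M × V => (z.1 + r z.2, s z.2)) (ubr bm tl tr om bv p q) =
        ubr bm tl' tr' om' bv'
          ((fun z : M × V => (z.1 + r z.2, s z.2)) p)
          ((fun z : M × V => (z.1 + r z.2, s z.2)) q)) ↔
    ((∀ (x : M) (v : V), s (tr x v) = tr' x (s v)) ∧
     (∀ (x : M) (v : V), tl x v + r (tr x v) = bm x (r v) + tl' x (s v)) ∧
     (∀ u v : V, s (bv u v) = bv' (s u) (s v) + tr' (r u) (s v) - tr' (r v) (s u)) ∧
     (∀ u v : V, om u v + r (bv u v) =
        bm (r u) (r v) + tl' (r u) (s v) - tl' (r v) (s u) + om' (s u) (s v))) := by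
  constructor
  · intro h
    have mixed (x : M) (v : V) := Prod.ext_iff.mp (h (x, 0) (0, v))
    have pure (u v : V) := Prod.ext_iff.mp (h (0, u) (0, v))
    simp only [ubr, hbm.map_zero_left, hbm.map_zero_right, htl.map_zero_left,
      htr.map_zero_left, hom.map_zero_left, hbv.map_zero_left,
      htl'.map_zero_right, htr'.map_zero_right, hom'.map_zero_left, hbv'.map_zero_left,
      map_zero, add_zero, zero_add, sub_zero] at mixed pure
    refine ⟨fun x v => (mixed x v).2, fun x v => (mixed x v).1, fun u v => ?_,
      fun u v => (pure u v).1⟩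
    rw [(pure u v).2]
    abel
  · rintro ⟨h_tr, h_tl, h_bv, h_om⟩ ⟨x, u⟩ ⟨y, v⟩
    simp only [ubr, Prod.mk.injEq, map_add, map_sub, hbm.map_add_left, hbm.map_add_right,
      htl'.map_add_left, htr'.map_add_left]
    refine ⟨?_, ?_⟩
    · linear_combination (norm := module)
        h_tl x v - h_tl y u + h_om u v - hbma (r u) y
    · rw [h_tr, h_tr, h_bv]
      abel

theorem existsUnique_shear_of_fixes_left (ψ : (M × V) →ₗ[k] (M × V))
    (hψ : ∀ x : M, ψ (x, 0) = (x, 0)) :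
    ∃! rs : (V →ₗ[k] M) × (V →ₗ[k] V),
      ∀ p : M × V, ψ p = (p.1 + rs.1 p.2, rs.2 p.2) := by
  refine ⟨(LinearMap.fst k M V ∘ₗ ψ ∘ₗ LinearMap.inr k M V,
    LinearMap.snd k M V ∘ₗ ψ ∘ₗ LinearMap.inr k M V), ?_, ?_⟩
  · rintro ⟨x, u⟩
    have hsplit : ((x, u) : M × V) = (x, 0) + (0, u) := by simp
    rw [hsplit, map_add, hψ]
    ext <;> simp
  · rintro ⟨r, s⟩ h
    ext u <;> simp [h]

theorem bijective_shear_iff (r : V →ₗ[k] M) (s : V →ₗ[k] V) :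
    Function.Bijective (fun z : M × V => (z.1 + r z.2, s z.2)) ↔ Function.Bijective s := by
  constructor
  · rintro ⟨hinj, hsurj⟩
    refine ⟨fun u v huv => ?_, fun v => ?_⟩
    · have h : ((-r u, u) : M × V) = (-r v, v) := hinj (by simp [huv])
      exact congrArg Prod.snd h
    · obtain ⟨z, hz⟩ := hsurj (0, v)
      exact ⟨z.2, congrArg Prod.snd hz⟩
  · rintro ⟨hinj, hsurj⟩
    refine ⟨?_, ?_⟩
    · rintro ⟨x, u⟩ ⟨y, v⟩ h
      obtain ⟨hfst, hsnd⟩ := Prod.mk.inj h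
      obtain rfl : u = v := hinj hsnd
      simpa using hfst
    · rintro ⟨y, v⟩
      obtain ⟨u, rfl⟩ := hsurj v
      exact ⟨(y - r u, u), by simp⟩

theorem shear_snd_eq_iff (r : V →ₗ[k] M) (s : V →ₗ[k] V) :
    (∀ z : M × V, ((z.1 + r z.2, s z.2) : M × V).2 = z.2) ↔ s = LinearMap.id :=
  ⟨fun h => LinearMap.ext fun u => h (0, u), fun h z => by simp [h]⟩

end

theorem stmt15 {k : Type*} [Field k] (h2 : (2 : k) ≠ 0) (h3 : (3 : k) ≠ 0) {M V : Type*} [AddCommGroup M] [Module k M] [AddCommGroup V] [Module k V]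
    (bm : M → M → M) (hbm : IsMalcevBracket k bm)
    (tl : M → V → M) (htl : IsBilin k tl)
    (tr : M → V → V) (htr : IsBilin k tr)
    (om : V → V → M) (hom : IsBilin k om) (homa : ∀ u v : V, om u v = - om v u)
    (bv : V → V → V) (hbv : IsBilin k bv) (hbva : ∀ u v : V, bv u v = - bv v u)
    (tl' : M → V → M) (htl' : IsBilin k tl')
    (tr' : M → V → V) (htr' : IsBilin k tr')
    (om' : V → V → M) (hom' : IsBilin k om') (homa' : ∀ u v : V, om' u v = - om' v u)
    (bv' : V → V → V) (hbv' : IsBilin k bv') (hbva' : ∀ u v : V, bv' u v = - bv' v u)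
    (huni : IsMalcevBracket k (ubr bm tl tr om bv))
    (huni' : IsMalcevBracket k (ubr bm tl' tr' om' bv')) :
    (∀ (r : V →ₗ[k] M) (s : V →ₗ[k] V),
      (∀ p q : M × V,
        (fun z : M × V => (z.1 + r z.2, s z.2)) (ubr bm tl tr om bv p q) =
          ubr bm tl' tr' om' bv'
            ((fun z : M × V => (z.1 + r z.2, s z.2)) p)
            ((fun z : M × V => (z.1 + r z.2, s z.2)) q)) ↔
      ((∀ (x : M) (v : V), s (tr x v) = tr' x (s v)) ∧
       (∀ (x : M) (v : V), tl x v + r (tr x v) = bm x (r v) + tl' x (s v)) ∧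
       (∀ u v : V, s (bv u v) = bv' (s u) (s v) + tr' (r u) (s v) - tr' (r v) (s u)) ∧
       (∀ u v : V, om u v + r (bv u v) =
          bm (r u) (r v) + tl' (r u) (s v) - tl' (r v) (s u) + om' (s u) (s v)))) ∧
    (∀ ψ : (M × V) →ₗ[k] (M × V),
      (∀ p q : M × V, ψ (ubr bm tl tr om bv p q) = ubr bm tl' tr' om' bv' (ψ p) (ψ q)) →
      (∀ x : M, ψ (x, 0) = (x, 0)) →
      ∃! rs : (V →ₗ[k] M) × (V →ₗ[k] V),
        ∀ p : M × V, ψ p = (p.1 + rs.1 p.2, rs.2 p.2)) ∧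
    (∀ (r : V →ₗ[k] M) (s : V →ₗ[k] V),
      (∀ p q : M × V,
        (fun z : M × V => (z.1 + r z.2, s z.2)) (ubr bm tl tr om bv p q) =
          ubr bm tl' tr' om' bv'
            ((fun z : M × V => (z.1 + r z.2, s z.2)) p)
            ((fun z : M × V => (z.1 + r z.2, s z.2)) q)) →
      ((Function.Bijective (fun z : M × V => (z.1 + r z.2, s z.2)) ↔ Function.Bijective s) ∧
       ((∀ z : M × V, ((z.1 + r z.2, s z.2) : M × V).2 = z.2) ↔ s = LinearMap.id))) := by
  exact ⟨fun r s => ubr_shear_iff hbm.1 hbm.2.1 htl htr hom hbv htl' htr' hom' hbv' r s,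
    fun ψ _ hψ => existsUnique_shear_of_fixes_left ψ hψ,
    fun r s _ => ⟨bijective_shear_iff r s, shear_snd_eq_iff r s⟩⟩
end
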